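/- arXiv:1305.4508 — 2 statements merged into one kernel-verified Lean document; each statement's English description precedes it below -/
import Mathlib

section
/- Let x = (x_1, ..., x_n) and y = (y_1, ..., y_n) be elements of (F_p + vF_p)^n with Σ_i x_i·y_i = 0 (i.e. x and y are orthogonal with respect to the Euclidean inner product). Then their Gray images φ(x) and φ(y) are orthogonal in F_p^{2n}, i.e. the standard inner product of φ(x) and φ(y) in F_p^{2n} is 0. -/
open Polynomial

/-- The ring `F_p + v F_p = F_p[v]/(v² − v)`. -/
abbrev Fv (p : ℕ) : Type := Polynomial (ZMod p) ⧸ Ideal.span {(X : Polynomial (ZMod p)) ^ 2 - X}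

/-- The element `v` of `F_p + v F_p`. -/
noncomputable def vv (p : ℕ) : Fv p :=
  Ideal.Quotient.mk (Ideal.span {(X : Polynomial (ZMod p)) ^ 2 - X}) X

/-- Evaluation at an idempotent `e`, as a ring homomorphism on `F_p + v F_p`. -/
noncomputable def Fv.evalHom (p : ℕ) (e : ZMod p) (he : e ^ 2 - e = 0) : Fv p →+* ZMod p :=
  Ideal.Quotient.lift _ (evalRingHom e) fun f hf => by
    obtain ⟨g, rfl⟩ := Ideal.mem_span_singleton.mp hf
    simp [he]

theorem Fv.evalHom_mk (p : ℕ) (e : ZMod p) (he : e ^ 2 - e = 0) (f : (ZMod p)[X]) :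
    Fv.evalHom p e he (Ideal.Quotient.mk _ f) = f.eval e :=
  rfl

theorem X_sq_sub_X_dvd {R : Type*} [CommRing R] {f : R[X]} (h0 : f.eval 0 = 0)
    (h1 : f.eval 1 = 0) : (X ^ 2 - X : R[X]) ∣ f := by
  have hX : (X : R[X]) ^ 2 - X = X * (X - C 1) := by rw [C_1]; ring
  rw [hX]
  refine IsCoprime.mul_dvd ⟨1, -1, by rw [C_1]; ring⟩ ?_ (dvd_iff_isRoot.mpr h1)
  simpa using (dvd_iff_isRoot (a := (0 : R))).mpr h0

theorem Fv.eq_add_mul_vv (p : ℕ) (z : Fv p) :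
    z = algebraMap (ZMod p) (Fv p) (Fv.evalHom p 0 (by ring) z) +
      algebraMap (ZMod p) (Fv p)
        (Fv.evalHom p 1 (by ring) z - Fv.evalHom p 0 (by ring) z) * vv p := by
  obtain ⟨f, rfl⟩ := Ideal.Quotient.mk_surjective z
  simp only [Fv.evalHom_mk]
  change Ideal.Quotient.mk _ f =
    Ideal.Quotient.mk _ (C (f.eval 0) + C (f.eval 1 - f.eval 0) * X)
  rw [Ideal.Quotient.mk_eq_mk_iff_sub_mem, Ideal.mem_span_singleton]
  exact X_sq_sub_X_dvd (by simp) (by simp)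

/-- if `x, y ∈ (F_p + vF_p)^n` are orthogonal for the Euclidean inner
product, then their Gray images are orthogonal in `F_p^{2n}`.  The Gray map
`φ : F_p + vF_p → F_p²` is characterized by `φ(a + b·v) = (−b, 2a + b)` and is
extended componentwise; the standard inner product of the Gray images of `x` and `y`
is `∑ i, ((φ (x i)).1 * (φ (y i)).1 + (φ (x i)).2 * (φ (y i)).2)`. -/
theorem stmt1 (p : ℕ) [Fact p.Prime] (hodd : Odd p) (n : ℕ)
    (φ : Fv p → ZMod p × ZMod p)
    (hφ : ∀ a b : ZMod p,
      φ (algebraMap (ZMod p) (Fv p) a + algebraMap (ZMod p) (Fv p) b * vv p) = (-b, 2 * a + b))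
    (x y : Fin n → Fv p)
    (hxy : ∑ i, x i * y i = 0) :
    ∑ i, ((φ (x i)).1 * (φ (y i)).1 + (φ (x i)).2 * (φ (y i)).2) = 0 := by
  have hgray : ∀ z, φ z = (Fv.evalHom p 0 (by ring) z - Fv.evalHom p 1 (by ring) z,
      Fv.evalHom p 0 (by ring) z + Fv.evalHom p 1 (by ring) z) := fun z => by
    conv_lhs => rw [Fv.eq_add_mul_vv p z, hφ]
    ext <;> dsimp only <;> ring
  have h0 := congrArg (Fv.evalHom p 0 (by ring)) hxy
  have h1 := congrArg (Fv.evalHom p 1 (by ring)) hxy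
  simp only [map_sum, map_mul, map_zero] at h0 h1
  calc _ = 2 * ∑ i, Fv.evalHom p 0 (by ring) (x i) * Fv.evalHom p 0 (by ring) (y i) +
        2 * ∑ i, Fv.evalHom p 1 (by ring) (x i) * Fv.evalHom p 1 (by ring) (y i) := by
        rw [Finset.mul_sum, Finset.mul_sum, ← Finset.sum_add_distrib]
        refine Finset.sum_congr rfl fun i _ => ?_
        rw [hgray, hgray]
        ring
    _ = 0 := by rw [h0, h1]; ring
end

section
/- If C is a self-dual code of length n over F_p + vF_p with respect to the Euclidean inner product, then its Gray image φ(C) is a self-dual linear code of length 2n over F_p. -/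
open Polynomial

namespace Fv

variable {p : ℕ}

/-- Evaluation of `a + b v` at an idempotent `e` of `F_p`, substituted for `v`. -/
noncomputable def evalAt (e : ZMod p) (he : e ^ 2 - e = 0) : Fv p →ₐ[ZMod p] ZMod p :=
  Ideal.Quotient.liftₐ _ (Polynomial.aeval e) fun f hf => by
    obtain ⟨g, rfl⟩ := Ideal.mem_span_singleton'.mp hf
    simp [he]

lemma evalAt_vv (e : ZMod p) (he : e ^ 2 - e = 0) : evalAt e he (vv p) = e := by
  change Polynomial.aeval e (X : Polynomial (ZMod p)) = e
  simp

/-- The ring homomorphism `a + b v ↦ a`. -/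
noncomputable abbrev ev₀ (p : ℕ) : Fv p →ₐ[ZMod p] ZMod p := evalAt 0 (by simp)

/-- The ring homomorphism `a + b v ↦ a + b`. -/
noncomputable abbrev ev₁ (p : ℕ) : Fv p →ₐ[ZMod p] ZMod p := evalAt 1 (by simp)

lemma vv_mul_vv : vv p * vv p = vv p := by
  rw [← sub_eq_zero, vv, ← map_mul, ← map_sub, Ideal.Quotient.eq_zero_iff_mem, ← pow_two]
  exact Ideal.mem_span_singleton_self _

lemma exists_eq_add_mul_vv (r : Fv p) : ∃ a b : ZMod p,
    r = algebraMap (ZMod p) (Fv p) a + algebraMap (ZMod p) (Fv p) b * vv p := by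
  obtain ⟨f, rfl⟩ := Ideal.Quotient.mk_surjective r
  induction f using Polynomial.induction_on with
  | C a => exact ⟨a, 0, by rw [map_zero, zero_mul, add_zero]; rfl⟩
  | add f g hf hg =>
    obtain ⟨a, b, hf⟩ := hf
    obtain ⟨c, d, hg⟩ := hg
    refine ⟨a + c, b + d, ?_⟩
    rw [map_add, hf, hg, map_add, map_add]
    ring
  | monomial k c h =>
    obtain ⟨a, b, h⟩ := h
    refine ⟨0, a + b, ?_⟩
    rw [pow_succ _ k, ← mul_assoc, map_mul, h, map_zero, map_add]
    change _ * vv p = _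
    linear_combination algebraMap (ZMod p) (Fv p) b * vv_mul_vv (p := p)

lemma ev₀_add_mul_vv (a b : ZMod p) :
    ev₀ p (algebraMap (ZMod p) (Fv p) a + algebraMap (ZMod p) (Fv p) b * vv p) = a := by
  rw [map_add, map_mul, AlgHom.commutes, AlgHom.commutes, evalAt_vv]
  simp

lemma ev₁_add_mul_vv (a b : ZMod p) :
    ev₁ p (algebraMap (ZMod p) (Fv p) a + algebraMap (ZMod p) (Fv p) b * vv p) = a + b := by
  rw [map_add, map_mul, AlgHom.commutes, AlgHom.commutes, evalAt_vv]
  simp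

lemma eq_zero_of_ev {r : Fv p} (h₀ : ev₀ p r = 0) (h₁ : ev₁ p r = 0) : r = 0 := by
  obtain ⟨a, b, rfl⟩ := exists_eq_add_mul_vv r
  rw [ev₀_add_mul_vv] at h₀
  rw [ev₁_add_mul_vv, h₀, zero_add] at h₁
  rw [h₀, h₁, map_zero, zero_mul, add_zero]

/-- The Gray map `a + b v ↦ (-b, 2 a + b)` as a linear map. -/
noncomputable def gray (p : ℕ) : Fv p →ₗ[ZMod p] ZMod p × ZMod p :=
  ((ev₀ p).toLinearMap - (ev₁ p).toLinearMap).prod ((ev₀ p).toLinearMap + (ev₁ p).toLinearMap)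

lemma gray_apply (r : Fv p) : gray p r = (ev₀ p r - ev₁ p r, ev₀ p r + ev₁ p r) := rfl

lemma gray_add_mul_vv (a b : ZMod p) :
    gray p (algebraMap (ZMod p) (Fv p) a + algebraMap (ZMod p) (Fv p) b * vv p) =
      (-b, 2 * a + b) := by
  rw [gray_apply, ev₀_add_mul_vv, ev₁_add_mul_vv]
  ext <;> ring

lemma gray_surjective [Fact p.Prime] (h2 : (2 : ZMod p) ≠ 0) :
    Function.Surjective (gray p) := by
  rintro ⟨s, t⟩
  refine ⟨_, (gray_add_mul_vv ((s + t) / 2) (-s)).trans ?_⟩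
  ext
  · ring
  · field_simp
    ring

lemma sum_gray_mul_gray {ι : Type*} [Fintype ι] (x y : ι → Fv p) :
    ∑ i, ((gray p (x i)).1 * (gray p (y i)).1 + (gray p (x i)).2 * (gray p (y i)).2) =
      2 * (ev₀ p (∑ i, x i * y i) + ev₁ p (∑ i, x i * y i)) := by
  rw [map_sum, map_sum, ← Finset.sum_add_distrib, Finset.mul_sum]
  refine Finset.sum_congr rfl fun i _ => ?_
  rw [map_mul, map_mul, gray_apply, gray_apply]
  ring

end Fv

/-- if `C` is a Euclidean self-dual code of length `n` over `F_p + vF_p`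
(`C` equals its Euclidean dual), then its componentwise Gray image is a self-dual
linear code of length `2n` over `F_p`: it is the underlying set of a `ZMod p`-subspace
`D` of `(F_p²)^n ≅ F_p^{2n}` which equals its dual with respect to the standard inner
product.  The Gray map `φ` is characterized by `φ(a + b·v) = (−b, 2a + b)`. -/
theorem stmt2 (p : ℕ) [Fact p.Prime] (hodd : Odd p) (n : ℕ)
    (φ : Fv p → ZMod p × ZMod p)
    (hφ : ∀ a b : ZMod p,
      φ (algebraMap (ZMod p) (Fv p) a + algebraMap (ZMod p) (Fv p) b * vv p) = (-b, 2 * a + b))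
    (C : Submodule (Fv p) (Fin n → Fv p))
    (hC : ∀ x : Fin n → Fv p, x ∈ C ↔ ∀ y ∈ C, ∑ i, x i * y i = 0) :
    ∃ D : Submodule (ZMod p) (Fin n → ZMod p × ZMod p),
      (D : Set (Fin n → ZMod p × ZMod p)) = (fun c : Fin n → Fv p => fun i => φ (c i)) '' (C : Set (Fin n → Fv p)) ∧
      ∀ u : Fin n → ZMod p × ZMod p,
        u ∈ D ↔ ∀ w ∈ D, ∑ i, ((u i).1 * (w i).1 + (u i).2 * (w i).2) = 0 := by
  have h2 : (2 : ZMod p) ≠ 0 := Ring.two_ne_zero <| by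
    rw [ZMod.ringChar_zmod_n]
    rintro rfl
    exact absurd hodd (by decide)
  have hφ_gray (r : Fv p) : φ r = Fv.gray p r := by
    obtain ⟨a, b, rfl⟩ := Fv.exists_eq_add_mul_vv r
    rw [hφ, Fv.gray_add_mul_vv]
  obtain rfl : φ = Fv.gray p := funext hφ_gray
  refine ⟨(C.restrictScalars (ZMod p)).map ((Fv.gray p).compLeft (Fin n)), rfl, fun u => ?_⟩
  constructor
  · rintro ⟨x, hx, rfl⟩ _ ⟨y, hy, rfl⟩
    refine (Fv.sum_gray_mul_gray x y).trans ?_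
    rw [(hC x).mp hx y hy]
    simp
  · intro h
    choose x hx using fun i => Fv.gray_surjective h2 (u i)
    obtain rfl : (fun i => Fv.gray p (x i)) = u := funext hx
    have trace_eq_zero (y : Fin n → Fv p) (hy : y ∈ C) :
        Fv.ev₀ p (∑ i, x i * y i) + Fv.ev₁ p (∑ i, x i * y i) = 0 := by
      have := h _ ⟨y, hy, rfl⟩
      exact (mul_eq_zero.mp ((Fv.sum_gray_mul_gray x y).symm.trans this)).resolve_left h2
    refine ⟨x, (hC x).mpr fun y hy => ?_, rfl⟩
    have h₁ := trace_eq_zero (vv p • y) (C.smul_mem _ hy)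
    have hsum : ∑ i, x i * (vv p • y) i = vv p * ∑ i, x i * y i := by
      rw [Finset.mul_sum]
      exact Finset.sum_congr rfl fun i _ => mul_left_comm _ _ _
    rw [hsum, map_mul, map_mul, Fv.evalAt_vv, Fv.evalAt_vv, zero_mul, one_mul, zero_add] at h₁
    have h₀ := trace_eq_zero y hy
    rw [h₁, add_zero] at h₀
    exact Fv.eq_zero_of_ev h₀ h₁
end
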